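/- arXiv:1810.12133 — 9 statements merged into one kernel-verified Lean document; each statement's English description precedes it below -/
import Mathlib

section
/- Let u, v : ℝ² → ℂ be continuously differentiable functions of (x,t). Then (u,v) satisfies the MT system if and only if for every λ ∈ ℂ∖{0} and every (x,t) ∈ ℝ² the zero-curvature identity ∂_t Q(x,t,λ) − ∂_x P(x,t,λ) + (i/4)(λ²−λ⁻²)[σ₃, P(x,t,λ)] − (i/4)(λ²+λ⁻²)[σ₃, Q(x,t,λ)] + [Q(x,t,λ), P(x,t,λ)] = 0 holds. (This identity is exactly the compatibility condition of the λ-Lax pair.) -/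
open Complex Matrix

noncomputable section

abbrev M2 : Type := Matrix (Fin 2) (Fin 2) ℂ

/-- partial derivative in `x` (first coordinate). -/
def pdx (f : ℝ × ℝ → ℂ) (p : ℝ × ℝ) : ℂ := fderiv ℝ f p (1, 0)

/-- partial derivative in `t` (second coordinate). -/
def pdt (f : ℝ × ℝ → ℂ) (p : ℝ × ℝ) : ℂ := fderiv ℝ f p (0, 1)

/-- entrywise partial derivative in `x` of a matrix-valued function. -/
def Mdx (M : ℝ × ℝ → M2) (p : ℝ × ℝ) : M2 := Matrix.of fun i j => pdx (fun q => M q i j) p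

/-- entrywise partial derivative in `t` of a matrix-valued function. -/
def Mdt (M : ℝ × ℝ → M2) (p : ℝ × ℝ) : M2 := Matrix.of fun i j => pdt (fun q => M q i j) p

def sigma3 : M2 := !![1, 0; 0, -1]

/-- matrix commutator. -/
def mcomm (A B : M2) : M2 := A * B - B * A

/-- `|w|²` as a complex number. -/
def nsq (w : ℂ) : ℂ := (Complex.normSq w : ℂ)

/-- complex conjugation. -/
def cj (w : ℂ) : ℂ := (starRingEnd ℂ) w

/-- the massive Thirring system. -/
def MTsys (u v : ℝ × ℝ → ℂ) : Prop :=
  ∀ p : ℝ × ℝ,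
    Complex.I * (pdt u p + pdx u p) + v p + nsq (v p) * u p = 0 ∧
    Complex.I * (pdt v p - pdx v p) + u p + nsq (u p) * v p = 0

/-- the matrix `Q(x,t,λ)` of the λ-Lax pair. -/
def Qmat (u v : ℝ × ℝ → ℂ) (l : ℂ) (p : ℝ × ℝ) : M2 :=
  (Complex.I / 4 * (nsq (u p) - nsq (v p))) • sigma3
    - (Complex.I * l / 2) • !![0, cj (v p); v p, 0]
    + (Complex.I / (2 * l)) • !![0, cj (u p); u p, 0]

/-- the matrix `P(x,t,λ)` of the λ-Lax pair. -/
def Pmat (u v : ℝ × ℝ → ℂ) (l : ℂ) (p : ℝ × ℝ) : M2 :=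
  (-(Complex.I / 4) * (nsq (u p) + nsq (v p))) • sigma3
    - (Complex.I * l / 2) • !![0, cj (v p); v p, 0]
    - (Complex.I / (2 * l)) • !![0, cj (u p); u p, 0]


lemma nsq_eq' (w : ℂ) : nsq w = w * cj w := by
  simp [nsq, cj, Complex.mul_conj]

lemma fd_diag (a b : ℂ) (u v : ℝ × ℝ → ℂ) (p d : ℝ × ℝ) (hu : DifferentiableAt ℝ u p)
    (hv : DifferentiableAt ℝ v p) :
    fderiv ℝ (fun q => a * (u q * cj (u q)) + b * (v q * cj (v q))) p d
      = a * (u p * cj (fderiv ℝ u p d) + fderiv ℝ u p d * cj (u p))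
        + b * (v p * cj (fderiv ℝ v p d) + fderiv ℝ v p d * cj (v p)) := by
  have hcu : HasFDerivAt (fun q => cj (u q)) _ p :=
    (Complex.conjCLE.toContinuousLinearMap.hasFDerivAt).comp p hu.hasFDerivAt
  have hcv : HasFDerivAt (fun q => cj (v q)) _ p :=
    (Complex.conjCLE.toContinuousLinearMap.hasFDerivAt).comp p hv.hasFDerivAt
  have h := ((hu.hasFDerivAt.mul hcu).const_mul a).add ((hv.hasFDerivAt.mul hcv).const_mul b)
  have h2 := h.fderiv
  have h3 := congrArg (fun L => L d) h2
  refine Eq.trans h3 ?_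
  simp [cj]
  ring

lemma fd_off (a b : ℂ) (u v : ℝ × ℝ → ℂ) (p d : ℝ × ℝ) (hu : DifferentiableAt ℝ u p)
    (hv : DifferentiableAt ℝ v p) :
    fderiv ℝ (fun q => a * u q + b * v q) p d
      = a * fderiv ℝ u p d + b * fderiv ℝ v p d := by
  have h := (hu.hasFDerivAt.const_mul a).add (hv.hasFDerivAt.const_mul b)
  refine Eq.trans (congrArg (fun L => L d) h.fderiv) ?_
  simp

lemma fd_offc (a b : ℂ) (u v : ℝ × ℝ → ℂ) (p d : ℝ × ℝ) (hu : DifferentiableAt ℝ u p)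
    (hv : DifferentiableAt ℝ v p) :
    fderiv ℝ (fun q => a * cj (u q) + b * cj (v q)) p d
      = a * cj (fderiv ℝ u p d) + b * cj (fderiv ℝ v p d) := by
  have hcu : HasFDerivAt (fun q => cj (u q)) _ p :=
    (Complex.conjCLE.toContinuousLinearMap.hasFDerivAt).comp p hu.hasFDerivAt
  have hcv : HasFDerivAt (fun q => cj (v q)) _ p :=
    (Complex.conjCLE.toContinuousLinearMap.hasFDerivAt).comp p hv.hasFDerivAt
  have h := (hcu.const_mul a).add (hcv.const_mul b)
  refine Eq.trans (congrArg (fun L => L d) h.fderiv) ?_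
  simp [cj]

lemma Q_eq (u v : ℝ × ℝ → ℂ) (l : ℂ) (p : ℝ × ℝ) : Qmat u v l p =
    !![(I/4) * (u p * cj (u p)) + (-(I/4)) * (v p * cj (v p)),
        (I / (2 * l)) * cj (u p) + (-(I * l / 2)) * cj (v p);
       (I / (2 * l)) * u p + (-(I * l / 2)) * v p,
        (-(I/4)) * (u p * cj (u p)) + (I/4) * (v p * cj (v p))] := by
  ext i j
  fin_cases i <;> fin_cases j <;> simp [Qmat, sigma3, nsq_eq'] <;> ring

lemma P_eq (u v : ℝ × ℝ → ℂ) (l : ℂ) (p : ℝ × ℝ) : Pmat u v l p =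
    !![(-(I/4)) * (u p * cj (u p)) + (-(I/4)) * (v p * cj (v p)),
        (-(I / (2 * l))) * cj (u p) + (-(I * l / 2)) * cj (v p);
       (-(I / (2 * l))) * u p + (-(I * l / 2)) * v p,
        (I/4) * (u p * cj (u p)) + (I/4) * (v p * cj (v p))] := by
  ext i j
  fin_cases i <;> fin_cases j <;> simp [Pmat, sigma3, nsq_eq'] <;> ring

lemma Qt_eq (u v : ℝ × ℝ → ℂ) (l : ℂ) (p : ℝ × ℝ) (hu : DifferentiableAt ℝ u p)
    (hv : DifferentiableAt ℝ v p) : Mdt (Qmat u v l) p =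
    !![(I/4) * (u p * cj (pdt u p) + pdt u p * cj (u p))
          + (-(I/4)) * (v p * cj (pdt v p) + pdt v p * cj (v p)),
        (I / (2 * l)) * cj (pdt u p) + (-(I * l / 2)) * cj (pdt v p);
       (I / (2 * l)) * pdt u p + (-(I * l / 2)) * pdt v p,
        (-(I/4)) * (u p * cj (pdt u p) + pdt u p * cj (u p))
          + (I/4) * (v p * cj (pdt v p) + pdt v p * cj (v p))] := by
  have e : Qmat u v l = fun p => _ := funext (Q_eq u v l)
  rw [e]
  ext i j
  fin_cases i <;> fin_cases j
  · exact fd_diag _ _ u v p _ hu hv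
  · exact fd_offc _ _ u v p _ hu hv
  · exact fd_off _ _ u v p _ hu hv
  · exact fd_diag _ _ u v p _ hu hv

lemma Px_eq (u v : ℝ × ℝ → ℂ) (l : ℂ) (p : ℝ × ℝ) (hu : DifferentiableAt ℝ u p)
    (hv : DifferentiableAt ℝ v p) : Mdx (Pmat u v l) p =
    !![(-(I/4)) * (u p * cj (pdx u p) + pdx u p * cj (u p))
          + (-(I/4)) * (v p * cj (pdx v p) + pdx v p * cj (v p)),
        (-(I / (2 * l))) * cj (pdx u p) + (-(I * l / 2)) * cj (pdx v p);
       (-(I / (2 * l))) * pdx u p + (-(I * l / 2)) * pdx v p,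
        (I/4) * (u p * cj (pdx u p) + pdx u p * cj (u p))
          + (I/4) * (v p * cj (pdx v p) + pdx v p * cj (v p))] := by
  have e : Pmat u v l = fun p => _ := funext (P_eq u v l)
  rw [e]
  ext i j
  fin_cases i <;> fin_cases j
  · exact fd_diag _ _ u v p _ hu hv
  · exact fd_offc _ _ u v p _ hu hv
  · exact fd_off _ _ u v p _ hu hv
  · exact fd_diag _ _ u v p _ hu hv

/-- left side of the first MT equation -/
def E1 (u v : ℝ × ℝ → ℂ) (p : ℝ × ℝ) : ℂ :=
  I * (pdt u p + pdx u p) + v p + nsq (v p) * u p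

/-- left side of the second MT equation -/
def E2 (u v : ℝ × ℝ → ℂ) (p : ℝ × ℝ) : ℂ :=
  I * (pdt v p - pdx v p) + u p + nsq (u p) * v p

lemma curv_eq (u v : ℝ × ℝ → ℂ) (l : ℂ) (hl : l ≠ 0) (p : ℝ × ℝ)
    (hu : DifferentiableAt ℝ u p) (hv : DifferentiableAt ℝ v p) :
    Mdt (Qmat u v l) p - Mdx (Pmat u v l) p
          + (Complex.I / 4 * (l ^ 2 - (l ^ 2)⁻¹)) • mcomm sigma3 (Pmat u v l p)
          - (Complex.I / 4 * (l ^ 2 + (l ^ 2)⁻¹)) • mcomm sigma3 (Qmat u v l p)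
          + mcomm (Qmat u v l p) (Pmat u v l p) =
    !![(1/4) * (cj (u p) * E1 u v p - u p * cj (E1 u v p)
          - cj (v p) * E2 u v p + v p * cj (E2 u v p)),
        (l/2) * cj (E2 u v p) - (1/(2*l)) * cj (E1 u v p);
       (1/(2*l)) * E1 u v p - (l/2) * E2 u v p,
        -((1/4) * (cj (u p) * E1 u v p - u p * cj (E1 u v p)
          - cj (v p) * E2 u v p + v p * cj (E2 u v p)))] := by
  have cE1 : cj (E1 u v p) = -I * (cj (pdt u p) + cj (pdx u p)) + cj (v p)
      + v p * cj (v p) * cj (u p) := by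
    simp [E1, cj, nsq_eq', mul_comm]
  have cE2 : cj (E2 u v p) = -I * (cj (pdt v p) - cj (pdx v p)) + cj (u p)
      + u p * cj (u p) * cj (v p) := by
    simp [E2, cj, nsq_eq', mul_comm]
  rw [cE1, cE2, Qt_eq u v l p hu hv, Px_eq u v l p hu hv, Q_eq, P_eq]
  simp only [E1, E2, nsq_eq']
  generalize pdt u p = ut
  generalize pdx u p = ux
  generalize pdt v p = vt
  generalize pdx v p = vx
  generalize cj ut = ut'
  generalize cj ux = ux'
  generalize cj vt = vt'
  generalize cj vx = vx'
  generalize cj (u p) = u'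
  generalize cj (v p) = v'
  generalize u p = u
  generalize v p = v
  have hI : I ^ 2 = -1 := Complex.I_sq
  have hI3 : I ^ 3 = -I := by rw [pow_succ, hI]; ring
  ext i j
  fin_cases i <;> fin_cases j <;>
    simp [mcomm, sigma3, Matrix.mul_apply, Fin.sum_univ_two] <;> field_simp <;>
    ring_nf <;> simp only [hI, hI3] <;> ring

/-- the MT system is equivalent to the zero-curvature identity of
the λ-Lax pair, for every nonzero spectral parameter λ and every point. -/
theorem mt_iff_zero_curvature_lambda
    (u v : ℝ × ℝ → ℂ) (hu : ContDiff ℝ 1 u) (hv : ContDiff ℝ 1 v) :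
    MTsys u v ↔
      ∀ l : ℂ, l ≠ 0 → ∀ p : ℝ × ℝ,
        Mdt (Qmat u v l) p - Mdx (Pmat u v l) p
          + (Complex.I / 4 * (l ^ 2 - (l ^ 2)⁻¹)) • mcomm sigma3 (Pmat u v l p)
          - (Complex.I / 4 * (l ^ 2 + (l ^ 2)⁻¹)) • mcomm sigma3 (Qmat u v l p)
          + mcomm (Qmat u v l p) (Pmat u v l p) = 0 := by
  have du : ∀ p, DifferentiableAt ℝ u p := fun p => hu.differentiable (by simp) p
  have dv : ∀ p, DifferentiableAt ℝ v p := fun p => hv.differentiable (by simp) p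
  constructor
  · intro h l hl p
    have h1 : E1 u v p = 0 := (h p).1
    have h2 : E2 u v p = 0 := (h p).2
    rw [curv_eq u v l hl p (du p) (dv p), h1, h2]
    ext i j
    fin_cases i <;> fin_cases j <;> simp [cj]
  · intro h p
    have a := h 1 one_ne_zero p
    have b := h 2 two_ne_zero p
    rw [curv_eq u v _ one_ne_zero p (du p) (dv p)] at a
    rw [curv_eq u v _ two_ne_zero p (du p) (dv p)] at b
    have a' := congrFun (congrFun a 1) 0
    have b' := congrFun (congrFun b 1) 0
    simp at a' b'
    have h1 : E1 u v p = 0 := by linear_combination (8/3) * a' - (4/3) * b'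
    have h2 : E2 u v p = 0 := by linear_combination (2/3) * a' - (4/3) * b'
    exact ⟨h1, h2⟩
end
end

section
/- Let u, v : ℝ² → ℂ be continuous and let μ ∈ ℂ∖{0}. Let B := [[0,−1],[1,0]]. If ψ : ℝ² → M₂(ℂ) is differentiable and satisfies the λ-Lax pair with parameter μ, i.e. ∂_x ψ − (i/4)(μ²−μ⁻²)[σ₃,ψ] = Q(x,t,μ)ψ and ∂_t ψ − (i/4)(μ²+μ⁻²)[σ₃,ψ] = P(x,t,μ)ψ, then the function χ(x,t) := B · conj(ψ(x,t)) · B (entrywise complex conjugation of ψ) satisfies the λ-Lax pair with parameter μ̄: ∂_x χ − (i/4)(μ̄²−μ̄⁻²)[σ₃,χ] = Q(x,t,μ̄)χ and ∂_t χ − (i/4)(μ̄²+μ̄⁻²)[σ₃,χ] = P(x,t,μ̄)χ. -/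
open Complex Matrix

noncomputable section

theorem fd_cj (f : ℝ × ℝ → ℂ) (p w : ℝ × ℝ) (hf : Differentiable ℝ f) :
    fderiv ℝ (fun q => cj (f q)) p w = cj (fderiv ℝ f p w) := by
  have h := (Complex.conjCLE.toContinuousLinearMap.hasFDerivAt (x := f p)).comp p
    (hf p).hasFDerivAt
  have h2 : HasFDerivAt (fun q => cj (f q))
    (Complex.conjCLE.toContinuousLinearMap.comp (fderiv ℝ f p)) p := h
  rw [h2.fderiv]; rfl

theorem fd_ncj (f : ℝ × ℝ → ℂ) (p w : ℝ × ℝ) (hf : Differentiable ℝ f) :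
    fderiv ℝ (fun q => -cj (f q)) p w = -cj (fderiv ℝ f p w) := by
  rw [← fd_cj f p w hf, fderiv_fun_neg]; rfl

theorem chi_eq (A : M2) : (!![0, -1; 1, 0] : M2) * A.map cj * !![0, -1; 1, 0]
    = !![-cj (A 1 1), cj (A 1 0); cj (A 0 1), -cj (A 0 0)] := by
  ext i j
  fin_cases i <;> fin_cases j <;> simp [Matrix.mul_apply, Fin.sum_univ_two, Matrix.vecMul, dotProduct]

/-- if `ψ` solves the λ-Lax pair with parameter `μ`, then
`χ = B ψ̄ B` (entrywise conjugation), `B = [[0,-1],[1,0]]`, solves the λ-Lax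
pair with parameter `μ̄`. -/
theorem lambda_lax_symmetry
    (u v : ℝ × ℝ → ℂ) (hu : Continuous u) (hv : Continuous v)
    (μ : ℂ) (hμ : μ ≠ 0) (ψ : ℝ × ℝ → M2)
    (hψ : ∀ i j, Differentiable ℝ fun p => ψ p i j)
    (hLx : ∀ p : ℝ × ℝ,
      Mdx ψ p - (Complex.I / 4 * (μ ^ 2 - (μ ^ 2)⁻¹)) • mcomm sigma3 (ψ p)
        = Qmat u v μ p * ψ p)
    (hLt : ∀ p : ℝ × ℝ,
      Mdt ψ p - (Complex.I / 4 * (μ ^ 2 + (μ ^ 2)⁻¹)) • mcomm sigma3 (ψ p)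
        = Pmat u v μ p * ψ p) :
    let Bm : M2 := !![0, -1; 1, 0]
    let ν : ℂ := cj μ
    let χ : ℝ × ℝ → M2 := fun p => Bm * (ψ p).map cj * Bm
    (∀ p : ℝ × ℝ,
        Mdx χ p - (Complex.I / 4 * (ν ^ 2 - (ν ^ 2)⁻¹)) • mcomm sigma3 (χ p)
          = Qmat u v ν p * χ p) ∧
    (∀ p : ℝ × ℝ,
        Mdt χ p - (Complex.I / 4 * (ν ^ 2 + (ν ^ 2)⁻¹)) • mcomm sigma3 (χ p)
          = Pmat u v ν p * χ p) := by
  intro Bm ν χ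
  have hχ : χ = fun p => !![-cj (ψ p 1 1), cj (ψ p 1 0); cj (ψ p 0 1), -cj (ψ p 0 0)] :=
    funext fun p => chi_eq (ψ p)
  rw [hχ]
  simp only [ν]
  clear hχ
  clear χ
  have c2 : (starRingEnd ℂ) 2 = 2 := Complex.conj_ofNat 2
  have c4 : (starRingEnd ℂ) 4 = 4 := Complex.conj_ofNat 4
  constructor
  · intro p
    have h := hLx p
    have h00 := congrArg cj (congrFun (congrFun h 0) 0)
    have h01 := congrArg cj (congrFun (congrFun h 0) 1)
    have h10 := congrArg cj (congrFun (congrFun h 1) 0)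
    have h11 := congrArg cj (congrFun (congrFun h 1) 1)
    clear h
    simp [Mdx, pdx, Qmat, mcomm, sigma3, Matrix.mul_apply, Fin.sum_univ_two, Matrix.vecMul, dotProduct, cj, nsq, c2, c4]
      at h00 h01 h10 h11
    ext i j
    fin_cases i <;> fin_cases j <;>
      simp [Mdx, pdx, Qmat, mcomm, sigma3, Matrix.mul_apply, Fin.sum_univ_two, Matrix.vecMul, dotProduct, fd_cj _ _ _ (hψ _ _), fd_ncj _ _ _ (hψ _ _)] <;> simp [cj, nsq, c2, c4]
    · linear_combination -h11
    · linear_combination h10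
    · linear_combination h01
    · linear_combination -h00
  · intro p
    have h := hLt p
    have h00 := congrArg cj (congrFun (congrFun h 0) 0)
    have h01 := congrArg cj (congrFun (congrFun h 0) 1)
    have h10 := congrArg cj (congrFun (congrFun h 1) 0)
    have h11 := congrArg cj (congrFun (congrFun h 1) 1)
    clear h
    simp [Mdt, pdt, Pmat, mcomm, sigma3, Matrix.mul_apply, Fin.sum_univ_two, Matrix.vecMul, dotProduct, cj, nsq, c2, c4]
      at h00 h01 h10 h11
    ext i j
    fin_cases i <;> fin_cases j <;>
      simp [Mdt, pdt, Pmat, mcomm, sigma3, Matrix.mul_apply, Fin.sum_univ_two, Matrix.vecMul, dotProduct, fd_cj _ _ _ (hψ _ _), fd_ncj _ _ _ (hψ _ _)] <;> simp [cj, nsq, c2, c4]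
    · linear_combination -h11
    · linear_combination h10
    · linear_combination h01
    · linear_combination -h00
end
end

section
/- Let u, v : ℝ² → ℂ be continuously differentiable and let ζ ∈ ℂ∖{0}. Suppose Ψ : ℝ² → M₂(ℂ) is differentiable and satisfies the z-Lax pair with parameter ζ: ∂_x Ψ − (i/4)(ζ−ζ⁻¹)[σ₃,Ψ] = 𝒰(x,t,ζ)Ψ and ∂_t Ψ − (i/4)(ζ+ζ⁻¹)[σ₃,Ψ] = 𝒱(x,t,ζ)Ψ. Define 𝒢(x,t) := [[ζ̄⁻¹ v̄(x,t), −ζ̄⁻¹],[1 + ζ̄⁻¹|v(x,t)|², −ζ̄⁻¹ v(x,t)]] and the constant matrix 𝒞 := [[0,1],[−ζ̄,0]]. Then Θ(x,t) := 𝒢(x,t) · conj(Ψ(x,t)) · 𝒞 (entrywise complex conjugation of Ψ) satisfies the z-Lax pair with parameter ζ̄: ∂_x Θ − (i/4)(ζ̄−ζ̄⁻¹)[σ₃,Θ] = 𝒰(x,t,ζ̄)Θ and ∂_t Θ − (i/4)(ζ̄+ζ̄⁻¹)[σ₃,Θ] = 𝒱(x,t,ζ̄)Θ. -/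
open Complex Matrix

noncomputable section

def cU1m (u v : ℝ × ℝ → ℂ) (p : ℝ × ℝ) : M2 :=
  !![(Complex.I/4) * (nsq (u p) + nsq (v p)), -(Complex.I/2) * cj (v p);
     pdx v p + (Complex.I/2) * nsq (u p) * v p + (Complex.I/2) * u p,
     -((Complex.I/4) * (nsq (u p) + nsq (v p)))]

def cU2m (u v : ℝ × ℝ → ℂ) (p : ℝ × ℝ) : M2 :=
  !![cj (u p) * v p, -cj (u p);
     v p + cj (u p) * (v p)^2, -(cj (u p) * v p)]

def cV1m (u v : ℝ × ℝ → ℂ) (p : ℝ × ℝ) : M2 :=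
  !![-(Complex.I/4) * (nsq (u p) - nsq (v p)), -(Complex.I/2) * cj (v p);
     pdt v p - (Complex.I/2) * nsq (u p) * v p - (Complex.I/2) * u p,
     (Complex.I/4) * (nsq (u p) - nsq (v p))]

/-- the matrix `𝒰(x,t,z)` of the z-Lax pair. -/
def cUmat (u v : ℝ × ℝ → ℂ) (z : ℂ) (p : ℝ × ℝ) : M2 :=
  cU1m u v p - (Complex.I/(2*z)) • cU2m u v p

/-- the matrix `𝒱(x,t,z)` of the z-Lax pair. -/
def cVmat (u v : ℝ × ℝ → ℂ) (z : ℂ) (p : ℝ × ℝ) : M2 :=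
  cV1m u v p + (Complex.I/(2*z)) • cU2m u v p

lemma hasF_cj {f : ℝ × ℝ → ℂ} {f' : ℝ × ℝ →L[ℝ] ℂ} {p : ℝ × ℝ} (h : HasFDerivAt f f' p) :
    HasFDerivAt (fun q => cj (f q)) ((Complex.conjCLE : ℂ →L[ℝ] ℂ).comp f') p :=
  (Complex.conjCLE : ℂ →L[ℝ] ℂ).hasFDerivAt.comp p h

lemma D_row0 (v a b : ℝ × ℝ → ℂ) (hv : Differentiable ℝ v) (ha : Differentiable ℝ a)
    (hb : Differentiable ℝ b) (k : ℂ) (p e : ℝ × ℝ) :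
    fderiv ℝ (fun q => k * (cj (v q) * cj (a q) - cj (b q))) p e
      = k * (cj (fderiv ℝ v p e) * cj (a p) + cj (v p) * cj (fderiv ℝ a p e)
        - cj (fderiv ℝ b p e)) := by
  have h := (((hasF_cj (hv p).hasFDerivAt).mul (hasF_cj (ha p).hasFDerivAt)).sub
    (hasF_cj (hb p).hasFDerivAt)).const_mul k
  have h2 := h.fderiv
  refine (congrArg (fun L => L e) h2).trans ?_
  simp [cj]
  left
  ring

lemma D_row1 (v a b : ℝ × ℝ → ℂ) (hv : Differentiable ℝ v) (ha : Differentiable ℝ a)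
    (hb : Differentiable ℝ b) (k l : ℂ) (p e : ℝ × ℝ) :
    fderiv ℝ (fun q => k * cj (a q) + l * (v q * (cj (v q) * cj (a q) - cj (b q)))) p e
      = k * cj (fderiv ℝ a p e) + l * (fderiv ℝ v p e * (cj (v p) * cj (a p) - cj (b p))
        + v p * (cj (fderiv ℝ v p e) * cj (a p) + cj (v p) * cj (fderiv ℝ a p e)
        - cj (fderiv ℝ b p e))) := by
  have h := ((hasF_cj (ha p).hasFDerivAt).const_mul k).add
    (((hv p).hasFDerivAt.mul
    (((hasF_cj (hv p).hasFDerivAt).mul (hasF_cj (ha p).hasFDerivAt)).sub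
    (hasF_cj (hb p).hasFDerivAt))).const_mul l)
  have h2 := h.fderiv
  refine (congrArg (fun L => L e) h2).trans ?_
  simp [cj]
  ring

set_option maxHeartbeats 2000000 in
/-- if `Ψ` solves the z-Lax pair with parameter `ζ`, then
`Θ = 𝒢 Ψ̄ 𝒞` (entrywise conjugation), with
`𝒢 = [[ζ̄⁻¹ v̄, -ζ̄⁻¹],[1+ζ̄⁻¹|v|², -ζ̄⁻¹ v]]` and `𝒞 = [[0,1],[-ζ̄,0]]`,
solves the z-Lax pair with parameter `ζ̄`. -/
theorem z_lax_symmetry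
    (u v : ℝ × ℝ → ℂ) (hu : ContDiff ℝ 1 u) (hv : ContDiff ℝ 1 v)
    (ζ : ℂ) (hζ : ζ ≠ 0) (Ψ : ℝ × ℝ → M2)
    (hΨ : ∀ i j, Differentiable ℝ fun p => Ψ p i j)
    (hLx : ∀ p : ℝ × ℝ,
      Mdx Ψ p - (Complex.I / 4 * (ζ - ζ⁻¹)) • mcomm sigma3 (Ψ p)
        = cUmat u v ζ p * Ψ p)
    (hLt : ∀ p : ℝ × ℝ,
      Mdt Ψ p - (Complex.I / 4 * (ζ + ζ⁻¹)) • mcomm sigma3 (Ψ p)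
        = cVmat u v ζ p * Ψ p) :
    let ζb : ℂ := cj ζ
    let G : ℝ × ℝ → M2 :=
      fun p => !![ζb⁻¹ * cj (v p), -ζb⁻¹; 1 + ζb⁻¹ * nsq (v p), -(ζb⁻¹ * v p)]
    let C : M2 := !![0, 1; -ζb, 0]
    let Θ : ℝ × ℝ → M2 := fun p => G p * (Ψ p).map cj * C
    (∀ p : ℝ × ℝ,
        Mdx Θ p - (Complex.I / 4 * (ζb - ζb⁻¹)) • mcomm sigma3 (Θ p)
          = cUmat u v ζb p * Θ p) ∧
    (∀ p : ℝ × ℝ,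
        Mdt Θ p - (Complex.I / 4 * (ζb + ζb⁻¹)) • mcomm sigma3 (Θ p)
          = cVmat u v ζb p * Θ p) := by
  intro ζb G C Θ
  have hz : ζb ≠ 0 := by simpa [ζb, cj] using hζ
  have hvd : Differentiable ℝ v := hv.differentiable (by norm_num)
  have e00 : (fun q => Θ q 0 0) = fun q => (-1 : ℂ) *
      (cj (v q) * cj (Ψ q 0 1) - cj (Ψ q 1 1)) := by
    funext q
    simp only [Θ, G, C, Matrix.mul_apply, Fin.sum_univ_two]
    simp [Fin.sum_univ_two]
    field_simp
    ring
  have e01 : (fun q => Θ q 0 1) = fun q => ζb⁻¹ *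
      (cj (v q) * cj (Ψ q 0 0) - cj (Ψ q 1 0)) := by
    funext q
    simp only [Θ, G, C, Matrix.mul_apply, Fin.sum_univ_two]
    simp [Fin.sum_univ_two]
    ring
  have e10 : (fun q => Θ q 1 0) = fun q => (-ζb) * cj (Ψ q 0 1) + (-1 : ℂ) *
      (v q * (cj (v q) * cj (Ψ q 0 1) - cj (Ψ q 1 1))) := by
    funext q
    simp only [Θ, G, C, Matrix.mul_apply, Fin.sum_univ_two]
    simp [Fin.sum_univ_two, nsq_eq']
    field_simp
    ring
  have e11 : (fun q => Θ q 1 1) = fun q => 1 * cj (Ψ q 0 0) + ζb⁻¹ *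
      (v q * (cj (v q) * cj (Ψ q 0 0) - cj (Ψ q 1 0))) := by
    funext q
    simp only [Θ, G, C, Matrix.mul_apply, Fin.sum_univ_two]
    simp [Fin.sum_univ_two, nsq_eq']
    ring
  have d00 := fun p e => D_row0 v _ _ hvd (hΨ 0 1) (hΨ 1 1) (-1) p e
  have d01 := fun p e => D_row0 v _ _ hvd (hΨ 0 0) (hΨ 1 0) ζb⁻¹ p e
  have d10 := fun p e => D_row1 v _ _ hvd (hΨ 0 1) (hΨ 1 1) (-ζb) (-1) p e
  have d11 := fun p e => D_row1 v _ _ hvd (hΨ 0 0) (hΨ 1 0) 1 ζb⁻¹ p e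
  simp only [← e00, ← e01, ← e10, ← e11] at d00 d01 d10 d11
  have cjz : (starRingEnd ℂ) ζ = ζb := rfl
  have cjdef : ∀ w, (starRingEnd ℂ) w = cj w := fun _ => rfl
  have cc : ∀ w, cj (cj w) = w := fun w => by simp [cj]
  have c2 : cj 2 = 2 := map_ofNat (starRingEnd ℂ) 2
  have c4 : cj 4 = 4 := map_ofNat (starRingEnd ℂ) 4
  constructor
  · intro p
    have H := fun i j => congrArg cj (sub_eq_iff_eq_add.mp (congrFun (congrFun (hLx p) i) j))
    have h00 := H 0 0
    have h01 := H 0 1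
    have h10 := H 1 0
    have h11 := H 1 1
    clear H
    have t00 := congrFun e00 p
    have t01 := congrFun e01 p
    have t10 := congrFun e10 p
    have t11 := congrFun e11 p
    have f00 := d00 p (1, 0)
    have f01 := d01 p (1, 0)
    have f10 := d10 p (1, 0)
    have f11 := d11 p (1, 0)
    clear d00 d01 d10 d11 e00 e01 e10 e11
    clear_value Θ
    simp [Mdx, pdx, mcomm, sigma3, cUmat, cU1m, cU2m, Matrix.mul_apply, Fin.sum_univ_two, nsq_eq', Matrix.vecMul, dotProduct] at h00 h01 h10 h11
    simp [cj] at h00 h01 h10 h11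
    simp only [cjz] at h00 h01 h10 h11
    simp only [cjdef, cc, c2, c4] at h00 h01 h10 h11
    ext i j
    fin_cases i <;> fin_cases j <;>
    simp [Mdx, pdx, mcomm, sigma3, cUmat, cU1m, cU2m, Matrix.mul_apply, Fin.sum_univ_two, nsq_eq', Matrix.vecMul, dotProduct, f00, f01, f10, f11, t00, t01, t10, t11, h00, h01, h10, h11] <;>
    field_simp <;> ring
  · intro p
    have H := fun i j => congrArg cj (sub_eq_iff_eq_add.mp (congrFun (congrFun (hLt p) i) j))
    have h00 := H 0 0
    have h01 := H 0 1
    have h10 := H 1 0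
    have h11 := H 1 1
    clear H
    have t00 := congrFun e00 p
    have t01 := congrFun e01 p
    have t10 := congrFun e10 p
    have t11 := congrFun e11 p
    have f00 := d00 p (0, 1)
    have f01 := d01 p (0, 1)
    have f10 := d10 p (0, 1)
    have f11 := d11 p (0, 1)
    clear d00 d01 d10 d11 e00 e01 e10 e11
    clear_value Θ
    simp [Mdt, pdt, mcomm, sigma3, cVmat, cV1m, cU2m, Matrix.mul_apply, Fin.sum_univ_two, nsq_eq', Matrix.vecMul, dotProduct] at h00 h01 h10 h11
    simp [cj] at h00 h01 h10 h11
    simp only [cjz] at h00 h01 h10 h11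
    simp only [cjdef, cc, c2, c4] at h00 h01 h10 h11
    ext i j
    fin_cases i <;> fin_cases j <;>
    simp [Mdt, pdt, mcomm, sigma3, cVmat, cV1m, cU2m, Matrix.mul_apply, Fin.sum_univ_two, nsq_eq', Matrix.vecMul, dotProduct, f00, f01, f10, f11, t00, t01, t10, t11, h00, h01, h10, h11] <;>
    field_simp <;> ring
end
end

section
/- Let u, v : ℝ² → ℂ be continuously differentiable functions of (x,t) satisfying the MT system. Fix t₀ ∈ ℝ and x ∈ ℝ. Assume that for each t in a neighborhood of t₀ the function ξ ↦ (|u(ξ,t)|² + |v(ξ,t)|²) is integrable on [x,∞), that there is an integrable function g on [x,∞) with |∂_t(|u(ξ,t)|² + |v(ξ,t)|²)| ≤ g(ξ) for all such t and all ξ ≥ x, and that (|u(ξ,t₀)|² − |v(ξ,t₀)|²) → 0 as ξ → ∞. Then the function Λ(x,t) := ∫_x^∞ (|u(ξ,t)|² + |v(ξ,t)|²) dξ is differentiable in t at t₀ and ∂_t Λ(x,t₀) = |u(x,t₀)|² − |v(x,t₀)|². -/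
open Complex Matrix

noncomputable section

open MeasureTheory Filter

theorem aux_nsq {f : ℝ → ℂ} {f' : ℂ} {t : ℝ} (h : HasDerivAt f f' t) :
    HasDerivAt (fun s => Complex.normSq (f s))
      (2 * ((f t).re * f'.re + (f t).im * f'.im)) t := by
  have h1 : HasDerivAt (fun s => (f s).re) f'.re t :=
    Complex.reCLM.hasFDerivAt.comp_hasDerivAt t h
  have h2 : HasDerivAt (fun s => (f s).im) f'.im t :=
    Complex.imCLM.hasFDerivAt.comp_hasDerivAt t h
  have h3 := (h1.mul h1).add (h2.mul h2)
  have h4 : (fun s => Complex.normSq (f s)) =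
      ((fun s => (f s).re) * fun s => (f s).re) + (fun s => (f s).im) * fun s => (f s).im := by
    funext s
    simp [Complex.normSq_apply]
  rw [h4]
  refine h3.congr_deriv ?_
  ring

theorem aux_t {u : ℝ × ℝ → ℂ} (hu : ContDiff ℝ 1 u) (ξ t : ℝ) :
    HasDerivAt (fun s => u (ξ, s)) (pdt u (ξ, t)) t :=
  ((hu.differentiable one_ne_zero (ξ, t)).hasFDerivAt).comp_hasDerivAt t
    ((hasDerivAt_const t ξ).prodMk (hasDerivAt_id t))

theorem aux_x {u : ℝ × ℝ → ℂ} (hu : ContDiff ℝ 1 u) (ξ t : ℝ) :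
    HasDerivAt (fun s => u (s, t)) (pdx u (ξ, t)) ξ :=
  ((hu.differentiable one_ne_zero (ξ, t)).hasFDerivAt).comp_hasDerivAt ξ
    ((hasDerivAt_id ξ).prodMk (hasDerivAt_const ξ t))

theorem aux_ct {u : ℝ × ℝ → ℂ} (hu : ContDiff ℝ 1 u) : Continuous (pdt u) :=
  (hu.continuous_fderiv one_ne_zero).clm_apply continuous_const

/-- differentiation of `Λ(x,t) = ∫ₓ^∞ (|u|²+|v|²)(ξ,t) dξ` in `t`
at `t₀`: under the stated integrability, domination and decay assumptions,
`∂ₜΛ(x,t₀) = |u(x,t₀)|² − |v(x,t₀)|²`. -/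
theorem mt_t_derivative_of_tail_integral
    (u v : ℝ × ℝ → ℂ) (hu : ContDiff ℝ 1 u) (hv : ContDiff ℝ 1 v)
    (hMT : MTsys u v) (t₀ x : ℝ) (δ : ℝ) (hδ : 0 < δ)
    (hInt : ∀ t : ℝ, |t - t₀| < δ →
      IntegrableOn (fun ξ => Complex.normSq (u (ξ, t)) + Complex.normSq (v (ξ, t)))
        (Set.Ici x))
    (g : ℝ → ℝ) (hg : IntegrableOn g (Set.Ici x))
    (hbound : ∀ t : ℝ, |t - t₀| < δ → ∀ ξ : ℝ, x ≤ ξ →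
      |fderiv ℝ (fun s => Complex.normSq (u (ξ, s)) + Complex.normSq (v (ξ, s))) t 1|
        ≤ g ξ)
    (hlim : Tendsto (fun ξ => Complex.normSq (u (ξ, t₀)) - Complex.normSq (v (ξ, t₀)))
      atTop (nhds 0)) :
    HasDerivAt
      (fun t => ∫ ξ in Set.Ici x, (Complex.normSq (u (ξ, t)) + Complex.normSq (v (ξ, t))))
      (Complex.normSq (u (x, t₀)) - Complex.normSq (v (x, t₀))) t₀ := by
  have hut := aux_t hu
  have hvt := aux_t hv
  have hux := aux_x hu
  have hvx := aux_x hv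
  set F' : ℝ → ℝ → ℝ := fun t ξ =>
    2 * ((u (ξ, t)).re * (pdt u (ξ, t)).re + (u (ξ, t)).im * (pdt u (ξ, t)).im) +
    2 * ((v (ξ, t)).re * (pdt v (ξ, t)).re + (v (ξ, t)).im * (pdt v (ξ, t)).im) with hF'
  have hd : ∀ t ξ, HasDerivAt
      (fun s => Complex.normSq (u (ξ, s)) + Complex.normSq (v (ξ, s))) (F' t ξ) t :=
    fun t ξ => (aux_nsq (hut ξ t)).add (aux_nsq (hvt ξ t))
  have hcont : Continuous (F' t₀) := by
    have c1 := aux_ct hu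
    have c2 := aux_ct hv
    have c3 := hu.continuous
    have c4 := hv.continuous
    have c5 := Complex.continuous_re
    have c6 := Complex.continuous_im
    simp only [hF']
    fun_prop
  have hball : ∀ t ∈ Metric.ball t₀ δ, |t - t₀| < δ := fun t ht => by
    rwa [Metric.mem_ball, Real.dist_eq] at ht
  have key := hasDerivAt_integral_of_dominated_loc_of_deriv_le
    (μ := volume.restrict (Set.Ici x)) (bound := g) (F' := F')
    (F := fun t ξ => Complex.normSq (u (ξ, t)) + Complex.normSq (v (ξ, t)))
    (Metric.ball_mem_nhds t₀ hδ)
    (by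
      filter_upwards [Metric.ball_mem_nhds t₀ hδ] with t ht
      exact (hInt t (hball t ht)).aestronglyMeasurable)
    (hInt t₀ (by simpa using hδ))
    hcont.aestronglyMeasurable
    (by
      filter_upwards [ae_restrict_mem measurableSet_Ici] with ξ hξ t ht
      have := hbound t (hball t ht) ξ hξ
      rw [fderiv_apply_one_eq_deriv, (hd t ξ).deriv] at this
      exact this)
    hg
    (Eventually.of_forall fun ξ t _ => hd t ξ)
  obtain ⟨hi, hder⟩ := key
  have hx : ∀ ξ ∈ Set.Ici x, HasDerivAt
      (fun ξ => Complex.normSq (u (ξ, t₀)) - Complex.normSq (v (ξ, t₀))) (-(F' t₀ ξ)) ξ := by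
    intro ξ _
    refine ((aux_nsq (hux ξ t₀)).sub (aux_nsq (hvx ξ t₀))).congr_deriv ?_
    obtain ⟨e1, e2⟩ := hMT (ξ, t₀)
    have a1 := congrArg Complex.re e1
    have a2 := congrArg Complex.im e1
    have b1 := congrArg Complex.re e2
    have b2 := congrArg Complex.im e2
    simp [nsq] at a1 a2 b1 b2
    simp only [hF']
    symm
    linear_combination (2 * (u (ξ, t₀)).im) * a1 - (2 * (u (ξ, t₀)).re) * a2 +
      (2 * (v (ξ, t₀)).im) * b1 - (2 * (v (ξ, t₀)).re) * b2
  have hfin := integral_Ioi_of_hasDerivAt_of_tendsto' hx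
    ((IntegrableOn.mono_set (t := Set.Ici x) hi Set.Ioi_subset_Ici_self).neg) hlim
  rw [integral_neg] at hfin
  rw [integral_Ici_eq_integral_Ioi (f := F' t₀)] at hder
  refine hder.congr_deriv ?_
  linarith
end
end

section
/- Let k ∈ ℝ∖{0}. Let u₀ : [0,∞) → ℂ be continuously differentiable and bounded with u₀(x) → 0 as x → ∞, and let v₀ : [0,∞) → ℂ be continuous. Suppose φ = (φ₁,φ₂) : [0,∞) → ℂ² is differentiable, satisfies φ₁′ − (i/2)(k⁻¹−k)φ₁ = U₀¹¹φ₁ + U₀¹²φ₂ and φ₂′ = U₀²¹φ₁ − U₀¹¹φ₂ on (0,∞), and φ(x) → (0,1) as x → ∞. Define a := φ₂(0), b := φ₁(0), ã := ā − ū₀(0) b̄, and b̃ := u₀(0) ā − (k + |u₀(0)|²) b̄. Then a ã − b b̃ = 1. -/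
open Complex Filter

noncomputable section

/-- the `(1,1)` entry of `U₀(x,k)`. -/
def U011 (u₀ v₀ : ℝ → ℂ) (k : ℂ) (x : ℝ) : ℂ :=
  -(Complex.I / 4) * (nsq (u₀ x) + nsq (v₀ x)) + (Complex.I / (2 * k)) * (u₀ x * cj (v₀ x))

/-- the `(1,2)` entry of `U₀(x,k)`. -/
def U012 (u₀ v₀ : ℝ → ℂ) (k : ℂ) (x : ℝ) : ℂ :=
  (Complex.I / 2) * cj (u₀ x) - (Complex.I / (2 * k)) * cj (v₀ x)

/-- the `(2,1)` entry of `U₀(x,k)`; `u₀'` is the derivative within `[0,∞)`. -/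
def U021 (u₀ v₀ : ℝ → ℂ) (k : ℂ) (x : ℝ) : ℂ :=
  derivWithin u₀ (Set.Ici 0) x - (Complex.I / 2) * u₀ x * nsq (v₀ x)
    - (Complex.I / 2) * v₀ x
    + (Complex.I / (2 * k)) * (u₀ x + (u₀ x) ^ 2 * cj (v₀ x))

/-- for real `k ≠ 0`, the spectral functions built from the
solution `φ` of the `x`-ODE normalized at infinity obey `a ã − b b̃ = 1`. -/
theorem x_spectral_functions_det_one
    (k : ℝ) (hk : k ≠ 0)
    (u₀ v₀ : ℝ → ℂ)
    (hu₀ : ContDiffOn ℝ 1 u₀ (Set.Ici 0))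
    (hu₀b : ∃ C : ℝ, ∀ x ∈ Set.Ici (0 : ℝ), ‖u₀ x‖ ≤ C)
    (hu₀0 : Tendsto u₀ atTop (nhds 0))
    (hv₀ : ContinuousOn v₀ (Set.Ici 0))
    (φ₁ φ₂ : ℝ → ℂ)
    (hφ₁c : ContinuousOn φ₁ (Set.Ici 0)) (hφ₂c : ContinuousOn φ₂ (Set.Ici 0))
    (hode : ∀ x ∈ Set.Ioi (0 : ℝ),
      HasDerivAt φ₁
        ((Complex.I / 2) * ((k : ℂ)⁻¹ - (k : ℂ)) * φ₁ x
          + U011 u₀ v₀ (k : ℂ) x * φ₁ x + U012 u₀ v₀ (k : ℂ) x * φ₂ x) x ∧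
      HasDerivAt φ₂
        (U021 u₀ v₀ (k : ℂ) x * φ₁ x - U011 u₀ v₀ (k : ℂ) x * φ₂ x) x)
    (hlim : Tendsto (fun x => (φ₁ x, φ₂ x)) atTop (nhds (0, 1))) :
    (φ₂ 0) * (cj (φ₂ 0) - cj (u₀ 0) * cj (φ₁ 0))
      - (φ₁ 0) * (u₀ 0 * cj (φ₂ 0) - ((k : ℂ) + nsq (u₀ 0)) * cj (φ₁ 0)) = 1 := by
  set F : ℝ → ℂ := fun x => (φ₂ x) * (cj (φ₂ x) - cj (u₀ x) * cj (φ₁ x))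
      - (φ₁ x) * (u₀ x * cj (φ₂ x) - ((k : ℂ) + u₀ x * cj (u₀ x)) * cj (φ₁ x)) with hF
  have hnsq : ∀ w : ℂ, nsq w = w * cj w := fun w => (Complex.mul_conj w).symm
  have hkC : (k : ℂ) ≠ 0 := by exact_mod_cast hk
  have hcj : Continuous cj := Complex.continuous_conj
  have hder : ∀ x ∈ Set.Ioi (0 : ℝ), HasDerivAt F 0 x := by
    intro x hx
    obtain ⟨h1, h2⟩ := hode x hx
    have hu : HasDerivAt u₀ (derivWithin u₀ (Set.Ici 0) x) x :=
      ((hu₀.differentiableOn one_ne_zero x (Set.Ioi_subset_Ici_self hx)).hasDerivWithinAt).hasDerivAt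
        (Ici_mem_nhds hx)
    have c1 := h1.star
    have c2 := h2.star
    have cu := hu.star
    have key := (h2.mul (c2.sub (cu.mul c1))).sub
      (h1.mul ((hu.mul c2).sub (((hu.mul cu).const_add (k : ℂ)).mul c1)))
    refine HasDerivAt.congr_deriv (f := F) key ?_
    simp only [U011, U012, U021, hnsq, cj, Pi.mul_apply, Pi.sub_apply, Pi.add_apply,
      ← starRingEnd_apply, map_add, map_sub, map_mul, map_div₀, map_neg, map_inv₀, map_pow,
      Complex.conj_I, Complex.conj_ofReal, Complex.conj_conj, map_ofNat]
    field_simp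
    ring
  have hconst : ∀ x ∈ Set.Ioi (0 : ℝ), F x = F 1 := by
    intro x hx
    exact isOpen_Ioi.is_const_of_deriv_eq_zero isPreconnected_Ioi
      (fun y hy => (hder y hy).differentiableAt.differentiableWithinAt)
      (fun y hy => (hder y hy).deriv) hx (Set.mem_Ioi.2 one_pos)
  have hG : Continuous (fun p : ℂ × ℂ × ℂ => p.2.2 * (cj p.2.2 - cj p.1 * cj p.2.1)
      - p.2.1 * (p.1 * cj p.2.2 - ((k : ℂ) + p.1 * cj p.1) * cj p.2.1)) := by
    fun_prop
  have hinf : Tendsto F atTop (nhds 1) := by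
    have := (hG.tendsto (0, 0, 1)).comp (hu₀0.prodMk_nhds hlim)
    simpa [cj, hF, Function.comp_def] using this
  have hF1 : F 1 = 1 := by
    refine tendsto_nhds_unique (tendsto_const_nhds.congr' ?_) hinf
    filter_upwards [eventually_gt_atTop (0 : ℝ)] with x hx using (hconst x hx).symm
  have hcont : ContinuousOn F (Set.Ici 0) :=
    hG.comp_continuousOn (hu₀.continuousOn.prodMk (hφ₁c.prodMk hφ₂c))
  have h0 : Tendsto F (nhdsWithin 0 (Set.Ioi 0)) (nhds (F 0)) :=
    (hcont 0 Set.self_mem_Ici).mono_left (nhdsWithin_mono _ Set.Ioi_subset_Ici_self)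
  have hF0 : F 0 = F 1 := by
    refine tendsto_nhds_unique h0 (tendsto_const_nhds.congr' ?_)
    filter_upwards [self_mem_nhdsWithin] with x hx using (hconst x hx).symm
  rw [hnsq]
  exact hF0.trans hF1
end
end

section
/- Let z ∈ ℝ∖{0}. Let v₀ : [0,∞) → ℂ be continuously differentiable and bounded with v₀(x) → 0 as x → ∞, and let u₀ : [0,∞) → ℂ be continuous. Suppose μ = (μ₁,μ₂) : [0,∞) → ℂ² is differentiable, satisfies μ₁′ − (i/2)(z−z⁻¹)μ₁ = 𝒰₀¹¹μ₁ + 𝒰₀¹²μ₂ and μ₂′ = 𝒰₀²¹μ₁ − 𝒰₀¹¹μ₂ on (0,∞), and μ(x) → (0,1) as x → ∞. Define 𝔞 := μ₂(0), 𝔟 := μ₁(0), 𝔞̃ := conj(𝔞) − v̄₀(0)·conj(𝔟), and 𝔟̃ := v₀(0)·conj(𝔞) − (z + |v₀(0)|²)·conj(𝔟). Then 𝔞 𝔞̃ − 𝔟 𝔟̃ = 1. -/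
open Complex Filter

noncomputable section

/-- the `(1,1)` entry of `𝒰₀(x,z)`. -/
def cU011 (u₀ v₀ : ℝ → ℂ) (z : ℂ) (x : ℝ) : ℂ :=
  (Complex.I / 4) * (nsq (u₀ x) + nsq (v₀ x)) - (Complex.I / (2 * z)) * (cj (u₀ x) * v₀ x)

/-- the `(1,2)` entry of `𝒰₀(x,z)`. -/
def cU012 (u₀ v₀ : ℝ → ℂ) (z : ℂ) (x : ℝ) : ℂ :=
  -(Complex.I / 2) * cj (v₀ x) + (Complex.I / (2 * z)) * cj (u₀ x)

/-- the `(2,1)` entry of `𝒰₀(x,z)`; `v₀'` is the derivative within `[0,∞)`. -/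
def cU021 (u₀ v₀ : ℝ → ℂ) (z : ℂ) (x : ℝ) : ℂ :=
  derivWithin v₀ (Set.Ici 0) x + (Complex.I / 2) * nsq (u₀ x) * v₀ x
    + (Complex.I / 2) * u₀ x
    - (Complex.I / (2 * z)) * (v₀ x + cj (u₀ x) * (v₀ x) ^ 2)

/-- for real `z ≠ 0`, the spectral functions built from the
solution `μ` of the `x`-ODE (z-plane) normalized at infinity obey
`𝔞 𝔞̃ − 𝔟 𝔟̃ = 1`. -/
theorem x_spectral_functions_det_one_z
    (z : ℝ) (hz : z ≠ 0)
    (u₀ v₀ : ℝ → ℂ)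
    (hv₀ : ContDiffOn ℝ 1 v₀ (Set.Ici 0))
    (hv₀b : ∃ C : ℝ, ∀ x ∈ Set.Ici (0 : ℝ), ‖v₀ x‖ ≤ C)
    (hv₀0 : Tendsto v₀ atTop (nhds 0))
    (hu₀ : ContinuousOn u₀ (Set.Ici 0))
    (μ₁ μ₂ : ℝ → ℂ)
    (hμ₁c : ContinuousOn μ₁ (Set.Ici 0)) (hμ₂c : ContinuousOn μ₂ (Set.Ici 0))
    (hode : ∀ x ∈ Set.Ioi (0 : ℝ),
      HasDerivAt μ₁
        ((Complex.I / 2) * ((z : ℂ) - (z : ℂ)⁻¹) * μ₁ x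
          + cU011 u₀ v₀ (z : ℂ) x * μ₁ x + cU012 u₀ v₀ (z : ℂ) x * μ₂ x) x ∧
      HasDerivAt μ₂
        (cU021 u₀ v₀ (z : ℂ) x * μ₁ x - cU011 u₀ v₀ (z : ℂ) x * μ₂ x) x)
    (hlim : Tendsto (fun x => (μ₁ x, μ₂ x)) atTop (nhds (0, 1))) :
    (μ₂ 0) * (cj (μ₂ 0) - cj (v₀ 0) * cj (μ₁ 0))
      - (μ₁ 0) * (v₀ 0 * cj (μ₂ 0) - ((z : ℂ) + nsq (v₀ 0)) * cj (μ₁ 0)) = 1 := by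
  have hsq : ∀ w : ℂ, nsq w = w * star w := fun w => (Complex.mul_conj w).symm
  have hzc : (z : ℂ) ≠ 0 := by exact_mod_cast hz
  have hzs : star (z : ℂ) = (z : ℂ) := Complex.conj_ofReal z
  have hIs : star Complex.I = -Complex.I := Complex.conj_I
  set F : ℝ → ℂ := fun x => (μ₂ x - v₀ x * μ₁ x) * star (μ₂ x - v₀ x * μ₁ x)
    + (z : ℂ) * (μ₁ x * star (μ₁ x)) with hF
  have hvc : ContinuousOn v₀ (Set.Ici 0) := hv₀.continuousOn
  have hFc : ContinuousOn F (Set.Ici 0) := by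
    have h := hμ₂c.sub (hvc.mul hμ₁c)
    exact (h.mul h.star).add (continuousOn_const.mul (hμ₁c.mul hμ₁c.star))
  have hFd : ∀ x ∈ Set.Ioi (0 : ℝ), HasDerivAt F 0 x := by
    intro x hx
    obtain ⟨h1, h2⟩ := hode x hx
    have hv : HasDerivAt v₀ (derivWithin v₀ (Set.Ici 0) x) x :=
      ((hv₀.differentiableOn one_ne_zero x (Set.Ioi_subset_Ici_self hx)).hasDerivWithinAt).hasDerivAt
        (Ici_mem_nhds hx)
    have hw := h2.sub (hv.mul h1)
    have hall := (hw.mul hw.star).add ((h1.mul h1.star).const_mul (z : ℂ))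
    have hw' : cU021 u₀ v₀ (z : ℂ) x * μ₁ x - cU011 u₀ v₀ (z : ℂ) x * μ₂ x
        - (derivWithin v₀ (Set.Ici 0) x * μ₁ x + v₀ x * ((Complex.I / 2) * ((z : ℂ) - (z : ℂ)⁻¹) * μ₁ x
          + cU011 u₀ v₀ (z : ℂ) x * μ₁ x + cU012 u₀ v₀ (z : ℂ) x * μ₂ x))
        = Complex.I / 2 * (u₀ x - z * v₀ x) * μ₁ x
          - Complex.I / 4 * (u₀ x * star (u₀ x) - v₀ x * star (v₀ x)) * (μ₂ x - v₀ x * μ₁ x) := by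
      simp only [cU011, cU012, cU021, hsq, cj, starRingEnd_apply]
      field_simp
      ring
    have h1' : (Complex.I / 2) * ((z : ℂ) - (z : ℂ)⁻¹) * μ₁ x
          + cU011 u₀ v₀ (z : ℂ) x * μ₁ x + cU012 u₀ v₀ (z : ℂ) x * μ₂ x
        = (Complex.I / 2) * ((z : ℂ) - (z : ℂ)⁻¹) * μ₁ x
          + Complex.I / 4 * (u₀ x * star (u₀ x) - v₀ x * star (v₀ x)) * μ₁ x
          + Complex.I / (2 * z) * (star (u₀ x) - z * star (v₀ x)) * (μ₂ x - v₀ x * μ₁ x) := by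
      simp only [cU011, cU012, hsq, cj, starRingEnd_apply]
      field_simp
      ring
    refine hall.congr_deriv ?_
    simp only [Pi.sub_apply, Pi.mul_apply]
    rw [hw', h1']
    generalize μ₂ x - v₀ x * μ₁ x = w
    simp only [star_add, star_sub, star_mul', star_div₀, star_inv₀, star_star, hzs, hIs, star_ofNat]
    field_simp
    ring
  have hconst : ∀ x ∈ Set.Ioi (0 : ℝ), F x = F 1 := fun x hx =>
    isOpen_Ioi.is_const_of_deriv_eq_zero isPreconnected_Ioi
      (fun y hy => (hFd y hy).differentiableAt.differentiableWithinAt)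
      (fun y hy => (hFd y hy).deriv) hx (Set.mem_Ioi.2 one_pos)
  have hl1 : Tendsto μ₁ atTop (nhds 0) := (continuous_fst.tendsto _).comp hlim
  have hl2 : Tendsto μ₂ atTop (nhds 1) := (continuous_snd.tendsto _).comp hlim
  have hFl : Tendsto F atTop (nhds 1) := by
    have h := hl2.sub (hv₀0.mul hl1)
    have h' := (h.mul h.star).add ((hl1.mul hl1.star).const_mul (z : ℂ))
    simpa [hF] using h'
  have hF1 : F 1 = 1 := by
    refine tendsto_nhds_unique (tendsto_const_nhds.congr' ?_) hFl
    filter_upwards [eventually_gt_atTop 0] with x hx using (hconst x hx).symm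
  have hF0 : F 0 = 1 := by
    have h0 : Tendsto F (nhdsWithin 0 (Set.Ioi 0)) (nhds (F 0)) :=
      (hFc 0 Set.self_mem_Ici).mono Set.Ioi_subset_Ici_self
    refine tendsto_nhds_unique h0 (tendsto_const_nhds.congr' ?_)
    filter_upwards [self_mem_nhdsWithin] with x hx
    rw [hconst x hx, hF1]
  rw [← hF0, hF]
  simp only [hsq, cj, starRingEnd_apply, star_sub, star_mul']
  ring
end
end

section
/- Let ε, a, b, ã, b̃, A, B, Ã, B̃ ∈ ℂ with ε ≠ 0, a ≠ 0, ã ≠ 0, A ≠ 0, Ã ≠ 0. Assume the determinant relations a ã − b b̃ = 1 and A Ã − B B̃ = 1, the global relation A b − a B = 0, and the conjugate global relation Ã b̃ − ã B̃ = 0. Set d := a Ã − b B̃ and d̃ := ã A − b̃ B, and assume d ≠ 0 and d̃ ≠ 0. Define the 2×2 complex matrices J₁ := [[1, 0],[ε⁻² B̃/(a d), 1]], J₃ := [[1, −ε² B/(ã d̃)],[0, 1]], J₄ := [[1, −ε² b/ã],[ε⁻² b̃/a, 1 − b b̃/(a ã)]], J₂ := J₃ J₄⁻¹ J₁ (J₄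 is invertible since det J₄ = 1), Ω¹ := [[a/A, 0],[0, A/a]], Ω² := [[d, −ε² b/Ã],[0, 1/d]], Ω³ := [[1/d̃, 0],[−ε⁻² b̃/A, d̃]], Ω⁴ := [[Ã/ã, 0],[0, ã/Ã]], and J := [[1, −ε² B/Ã],[ε⁻² B̃/A, 1/(A Ã)]]. Then the four intertwining identities hold: J₁ Ω² = Ω¹ J, J₂ Ω² = Ω³ J, J₃ Ω⁴ = Ω³ J, and J₄ Ω⁴ = Ω¹ J. -/
open Matrix

noncomputable section

/-- the intertwining identities relating the jump matrices of the
Riemann–Hilbert problem at `x = 0` to the jump matrix of the boundary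
Riemann–Hilbert problem. -/
theorem jump_matrix_intertwining
    (ε a b at' bt A B At Bt : ℂ)
    (hε : ε ≠ 0) (ha : a ≠ 0) (hat : at' ≠ 0) (hA : A ≠ 0) (hAt : At ≠ 0)
    (hdet1 : a * at' - b * bt = 1) (hdet2 : A * At - B * Bt = 1)
    (hGR : A * b - a * B = 0) (hGRt : At * bt - at' * Bt = 0)
    (d dt : ℂ) (hd : d = a * At - b * Bt) (hdt : dt = at' * A - bt * B)
    (hd0 : d ≠ 0) (hdt0 : dt ≠ 0) :
    let J1 : M2 := !![1, 0; (ε ^ 2)⁻¹ * Bt / (a * d), 1]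
    let J3 : M2 := !![1, -(ε ^ 2 * B / (at' * dt)); 0, 1]
    let J4 : M2 := !![1, -(ε ^ 2 * b / at'); (ε ^ 2)⁻¹ * bt / a, 1 - b * bt / (a * at')]
    let J2 : M2 := J3 * J4⁻¹ * J1
    let Ω1 : M2 := !![a / A, 0; 0, A / a]
    let Ω2 : M2 := !![d, -(ε ^ 2 * b / At); 0, 1 / d]
    let Ω3 : M2 := !![1 / dt, 0; -((ε ^ 2)⁻¹ * bt / A), dt]
    let Ω4 : M2 := !![At / at', 0; 0, at' / At]
    let J : M2 := !![1, -(ε ^ 2 * B / At); (ε ^ 2)⁻¹ * Bt / A, 1 / (A * At)]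
    J1 * Ω2 = Ω1 * J ∧ J2 * Ω2 = Ω3 * J ∧ J3 * Ω4 = Ω3 * J ∧ J4 * Ω4 = Ω1 * J := by
  have e1 : a = d * A := by
    rw [hd]; linear_combination (-a) * hdet2 + Bt * hGR
  have e2 : b = d * B := by
    apply mul_left_cancel₀ hA
    linear_combination hGR + B * e1
  have e0 : At = d * at' := by
    rw [hd]; linear_combination (-At) * hdet1 - b * hGRt
  have e3 : Bt = d * bt := by
    apply mul_left_cancel₀ hat
    linear_combination -hGRt + bt * e0
  have e4 : dt = d⁻¹ := by
    have : d * dt = 1 := by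
      rw [hdt]; linear_combination hdet1 - at' * e1 + bt * e2
    exact eq_inv_of_mul_eq_one_right this
  clear hd hdt hdet2 hGR hGRt
  subst e1 e2 e0 e3 e4
  have hB : B * bt = A * at' - 1 / d := by
    field_simp; linear_combination -hdet1
  intro J1 J3 J4 J2 Ω1 Ω2 Ω3 Ω4 J
  have h1 : J1 * Ω2 = Ω1 * J := by
    ext i j
    fin_cases i <;> fin_cases j <;> simp [J1, Ω2, Ω1, J, Matrix.mul_apply, Fin.sum_univ_two] <;>
      field_simp <;> first | done | linear_combination hdet1 | (ring_nf; done)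
  have h3 : J3 * Ω4 = Ω3 * J := by
    ext i j
    fin_cases i <;> fin_cases j <;> simp [J3, Ω4, Ω3, J, Matrix.mul_apply, Fin.sum_univ_two] <;>
      field_simp <;> first | done | linear_combination hdet1 | (ring_nf; done)
  have h4 : J4 * Ω4 = Ω1 * J := by
    ext i j
    fin_cases i <;> fin_cases j <;> simp [J4, Ω4, Ω1, J, Matrix.mul_apply, Fin.sum_univ_two] <;>
      field_simp <;> first | done | linear_combination hdet1 | (ring_nf; done)
  have hJ4 : IsUnit J4.det := by
    have : J4.det = 1 := by
      simp only [J4, Matrix.det_fin_two_of]; field_simp; ring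
    rw [this]; exact isUnit_one
  refine ⟨h1, ?_, h3, h4⟩
  calc J2 * Ω2 = J3 * (J4⁻¹ * (J1 * Ω2)) := by simp only [J2, Matrix.mul_assoc]
    _ = Ω3 * J := by
      rw [h1, ← h4, Matrix.nonsing_inv_mul_cancel_left _ _ hJ4, h3]
end
end

section
/- Let ε ∈ {1, −1} and let u : ℝ² → ℂ be continuously differentiable in (x,t). Define v : ℝ² → ℂ by v(x,t) := ε·u(−x,t). Then the pair (u,v) satisfies the MT system at every point of ℝ² if and only if u satisfies the nonlocal massive Thirring equation i(∂_t u(x,t) + ∂_x u(x,t)) + ε·u(−x,t) + |u(−x,t)|²·u(x,t) = 0 at every point (x,t) ∈ ℝ². -/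
open Complex Matrix

noncomputable section

/-- under the nonlocal reduction `v(x,t) = ε u(−x,t)`, `ε = ±1`,
the MT system for `(u,v)` is equivalent to the nonlocal massive Thirring
equation for `u`. -/
theorem mt_nonlocal_reduction
    (ε : ℂ) (hε : ε = 1 ∨ ε = -1)
    (u : ℝ × ℝ → ℂ) (hu : ContDiff ℝ 1 u)
    (v : ℝ × ℝ → ℂ) (hv : ∀ p : ℝ × ℝ, v p = ε * u (-p.1, p.2)) :
    MTsys u v ↔
      ∀ p : ℝ × ℝ,
        Complex.I * (pdt u p + pdx u p) + ε * u (-p.1, p.2)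
          + nsq (u (-p.1, p.2)) * u p = 0 := by
  have hd : Differentiable ℝ u := hu.differentiable (by norm_num)
  have hve : v = fun p : ℝ × ℝ => ε * u (-p.1, p.2) := funext hv
  have hF : ∀ p : ℝ × ℝ, HasFDerivAt v
      (ε • ((fderiv ℝ u (-p.1, p.2)).comp
        ((-(ContinuousLinearMap.fst ℝ ℝ ℝ)).prod (ContinuousLinearMap.snd ℝ ℝ ℝ)))) p := by
    intro p
    rw [hve]
    have h1 : HasFDerivAt (fun q : ℝ × ℝ => (-q.1, q.2))
        ((-(ContinuousLinearMap.fst ℝ ℝ ℝ)).prod (ContinuousLinearMap.snd ℝ ℝ ℝ)) p :=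
      (hasFDerivAt_fst.neg).prodMk hasFDerivAt_snd
    have h2 : HasFDerivAt u (fderiv ℝ u (-p.1, p.2)) ((fun q : ℝ × ℝ => (-q.1, q.2)) p) :=
      (hd _).hasFDerivAt
    exact (h2.comp p h1).const_mul ε
  have ht : ∀ p : ℝ × ℝ, pdt v p = ε * pdt u (-p.1, p.2) := by
    intro p
    simp [pdt, (hF p).fderiv]
  have hx : ∀ p : ℝ × ℝ, pdx v p = -(ε * pdx u (-p.1, p.2)) := by
    intro p
    have h3 : ((-1 : ℝ), (0 : ℝ)) = -((1 : ℝ), (0 : ℝ)) := by simp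
    simp only [pdx, (hF p).fderiv]
    simp [h3, -Prod.neg_mk]
  have he : ε * ε = 1 := by rcases hε with h | h <;> simp [h]
  have hn : ∀ w : ℂ, nsq (ε * w) = nsq w := by
    intro w
    rcases hε with h | h <;> simp [h, nsq]
  constructor
  · intro h p
    have h1 := (h p).1
    rw [hv p, hn] at h1
    exact h1
  · intro h p
    refine ⟨?_, ?_⟩
    · rw [hv p, hn]
      exact h p
    · have h1 := h (-p.1, p.2)
      simp only [neg_neg, Prod.mk.eta] at h1
      rw [ht, hx, hv p]
      linear_combination ε * h1 - u p * he
end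
end

section
/- Let k ∈ ℝ∖{0}, let u₀ : [0,∞) → ℂ be continuously differentiable, and let v₀ : [0,∞) → ℂ be continuous. Suppose φ = (φ₁,φ₂) : [0,∞) → ℂ² is differentiable and satisfies φ₁′ − (i/2)(k⁻¹−k)φ₁ = U₀¹¹φ₁ + U₀¹²φ₂ and φ₂′ = U₀²¹φ₁ − U₀¹¹φ₂ on (0,∞). Define φ̃ = (φ̃₁,φ̃₂) by φ̃₁ := −ū₀ φ̄₁ + φ̄₂ and φ̃₂ := −(k + |u₀|²) φ̄₁ + u₀ φ̄₂ (bars denoting complex conjugation). Then φ̃ satisfies the companion system φ̃₁′ = U₀¹¹φ̃₁ + U₀¹²φ̃₂ and φ̃₂′ + (i/2)(k⁻¹−k)φ̃₂ = U₀²¹φ̃₁ − U₀¹¹φ̃₂ on (0,∞); equivalently, the 2×2 matrix Φ with first column φ̃ and second column φ satisfies ∂_x Φ − (i/4)(k⁻¹−k)[σ₃,Φ] = U₀ Φ, where U₀ is the matrix [[U₀¹¹, U₀¹²],[U₀²¹, −U₀¹¹]] and σ₃ := [[1,0],[0,−1]]. -/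
open Complex Filter

noncomputable section

/-- if `φ = (φ₁,φ₂)` solves the `x`-part of the k-Lax ODE (real
`k ≠ 0`), then `φ̃₁ = −ū₀ φ̄₁ + φ̄₂`, `φ̃₂ = −(k+|u₀|²) φ̄₁ + u₀ φ̄₂` solves the
companion system `φ̃₁′ = U₀¹¹φ̃₁ + U₀¹²φ̃₂`,
`φ̃₂′ + (i/2)(k⁻¹−k)φ̃₂ = U₀²¹φ̃₁ − U₀¹¹φ̃₂` on `(0,∞)`; i.e. the matrix with
columns `(φ̃, φ)` solves `∂ₓΦ − (i/4)(k⁻¹−k)[σ₃,Φ] = U₀Φ`. -/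
theorem companion_solution_x_ode
    (k : ℝ) (hk : k ≠ 0)
    (u₀ v₀ : ℝ → ℂ)
    (hu₀ : ContDiffOn ℝ 1 u₀ (Set.Ici 0))
    (hv₀ : ContinuousOn v₀ (Set.Ici 0))
    (φ₁ φ₂ : ℝ → ℂ)
    (hode : ∀ x ∈ Set.Ioi (0 : ℝ),
      HasDerivAt φ₁
        ((Complex.I / 2) * ((k : ℂ)⁻¹ - (k : ℂ)) * φ₁ x
          + U011 u₀ v₀ (k : ℂ) x * φ₁ x + U012 u₀ v₀ (k : ℂ) x * φ₂ x) x ∧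
      HasDerivAt φ₂
        (U021 u₀ v₀ (k : ℂ) x * φ₁ x - U011 u₀ v₀ (k : ℂ) x * φ₂ x) x) :
    let φt₁ : ℝ → ℂ := fun x => -cj (u₀ x) * cj (φ₁ x) + cj (φ₂ x)
    let φt₂ : ℝ → ℂ := fun x => -((k : ℂ) + nsq (u₀ x)) * cj (φ₁ x) + u₀ x * cj (φ₂ x)
    ∀ x ∈ Set.Ioi (0 : ℝ),
      HasDerivAt φt₁
        (U011 u₀ v₀ (k : ℂ) x * φt₁ x + U012 u₀ v₀ (k : ℂ) x * φt₂ x) x ∧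
      HasDerivAt φt₂
        (-(Complex.I / 2) * ((k : ℂ)⁻¹ - (k : ℂ)) * φt₂ x
          + U021 u₀ v₀ (k : ℂ) x * φt₁ x - U011 u₀ v₀ (k : ℂ) x * φt₂ x) x := by
  intro φt₁ φt₂ x hx
  obtain ⟨h1, h2⟩ := hode x hx
  have hx0 : (0 : ℝ) < x := hx
  have hu : HasDerivAt u₀ (derivWithin u₀ (Set.Ici 0) x) x :=
    ((hu₀.differentiableOn (by norm_num)) x hx0.le).hasDerivWithinAt.hasDerivAt
      (Ici_mem_nhds hx0)
  have hkc : (k : ℂ) ≠ 0 := by exact_mod_cast hk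
  have c1 : HasDerivAt (fun y => cj (φ₁ y)) _ x := h1.star
  have c2 : HasDerivAt (fun y => cj (φ₂ y)) _ x := h2.star
  have cu : HasDerivAt (fun y => cj (u₀ y)) _ x := hu.star
  have hn : ∀ w : ℂ, nsq w = w * cj w := fun w => (Complex.mul_conj w).symm
  have e1 : φt₁ = fun y => -cj (u₀ y) * cj (φ₁ y) + cj (φ₂ y) := rfl
  have e2 : φt₂ = fun y => -((k : ℂ) + u₀ y * cj (u₀ y)) * cj (φ₁ y) + u₀ y * cj (φ₂ y) := by
    funext y
    simp only [φt₂, hn]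
  rw [e1, e2]
  constructor
  · refine ((cu.neg.mul c1).add c2).congr_deriv ?_
    simp only [U011, U012, U021, hn, cj, Complex.star_def, map_add, map_sub, map_mul, map_neg,
      map_div₀, map_inv₀, map_pow, Complex.conj_I, Complex.conj_ofReal, Complex.conj_conj,
      map_ofNat, Pi.neg_apply]
    field_simp
    ring
  · refine ((((hu.mul cu).const_add (k : ℂ)).neg.mul c1).add (hu.mul c2)).congr_deriv ?_
    simp only [U011, U012, U021, hn, cj, Complex.star_def, map_add, map_sub, map_mul, map_neg,
      map_div₀, map_inv₀, map_pow, Complex.conj_I, Complex.conj_ofReal, Complex.conj_conj,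
      map_ofNat, Pi.neg_apply, Pi.mul_apply]
    field_simp
    ring
end
end
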